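/- arXiv:2603.01244 — 4 statements merged into one kernel-verified Lean document; each statement's English description precedes it below -/
import Mathlib

section
/- Let (G, S, t) be a Hexasort instance whose stacks use a finite set C of colors and all of whose stack heights are at least 1. If G contains a vertex of degree at least |C|·t, then S is fittable on (G, t). -/
open scoped Classical

namespace Hexasort

/-- A board configuration: each vertex holds either a stack `(color, height)` or nothing. -/
abbrev Config (V C : Type*) := V → Option (C × ℕ)

/-- The everywhere-empty configuration. -/
def emptyConfig (V C : Type*) : Config V C := fun _ => none

/-- The height contributed by a board entry to color `c` (0 if empty or another color). -/
noncomputable def colorHeight {C : Type*} (e : Option (C × ℕ)) (c : C) : ℕ :=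
  match e with
  | none => 0
  | some (c', h) => if c' = c then h else 0

/-- Total height of the color-`c` stacks on the neighbors of `x`. -/
noncomputable def neighborSum {V C : Type*} [Fintype V] (G : SimpleGraph V)
    (δ : Config V C) (c : C) (x : V) : ℕ :=
  ∑ y ∈ Finset.univ.filter (fun y => G.Adj x y), colorHeight (δ y) c

/-- The configuration resulting from placing the stack `s` on the vertex `x`:
all same-colored neighbors are emptied, and `x` gets the merged stack unless
its total height reaches the threshold `t`, in which case `x` becomes empty. -/
noncomputable def place {V C : Type*} [Fintype V] (G : SimpleGraph V) (t : ℕ)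
    (δ : Config V C) (s : C × ℕ) (x : V) : Config V C :=
  fun v =>
    if v = x then
      (if t ≤ s.2 + neighborSum G δ s.1 x then none
       else some (s.1, s.2 + neighborSum G δ s.1 x))
    else if G.Adj x v ∧ (∃ hh, δ v = some (s.1, hh)) then none
    else δ v

/-- Play a sequence of stacks on a sequence of vertices, starting from `δ`. -/
noncomputable def play {V C : Type*} [Fintype V] (G : SimpleGraph V) (t : ℕ) :
    Config V C → List (C × ℕ) → List V → Config V C
  | δ, [], _ => δ
  | δ, _ :: _, [] => δ
  | δ, s :: S, x :: p => play G t (place G t δ s x) S p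

/-- Legality of playing the stacks `S` on the vertices `p`, starting from `δ`:
each stack is placed on a vertex that is empty at that moment. -/
inductive Legal {V C : Type*} [Fintype V] (G : SimpleGraph V) (t : ℕ) :
    Config V C → List (C × ℕ) → List V → Prop
  | nil (δ : Config V C) : Legal G t δ [] []
  | cons {δ : Config V C} (s : C × ℕ) (S : List (C × ℕ)) (x : V) (p : List V) :
      δ x = none → Legal G t (place G t δ s x) S p →
      Legal G t δ (s :: S) (x :: p)

/-- `S` is fittable on `(G, t)`: all stacks can be placed in order. -/
def Fittable {V C : Type*} [Fintype V] (G : SimpleGraph V) (t : ℕ)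
    (S : List (C × ℕ)) : Prop :=
  ∃ p : List V, Legal G t (emptyConfig V C) S p

/-- `S` is emptyable on `(G, t)`: all stacks can be placed in order so that the
final configuration is everywhere empty. -/
def Emptyable {V C : Type*} [Fintype V] (G : SimpleGraph V) (t : ℕ)
    (S : List (C × ℕ)) : Prop :=
  ∃ p : List V, Legal G t (emptyConfig V C) S p ∧
    play G t (emptyConfig V C) S p = emptyConfig V C

end Hexasort

namespace Hexasort

/-- total height of a color on the board -/
noncomputable def total {V C : Type*} [Fintype V] (δ : Config V C) (c : C) : ℕ :=
  ∑ z, colorHeight (δ z) c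

lemma total_place_ne {V C : Type*} [Fintype V] (G : SimpleGraph V) (t : ℕ)
    (δ : Config V C) (s : C × ℕ) (x : V) (c : C) (hc : s.1 ≠ c) :
    total (place G t δ s x) c ≤ total δ c := by
  unfold total
  apply Finset.sum_le_sum
  intro z _
  unfold place
  split_ifs <;> simp [colorHeight, hc]

lemma total_place_eq {V C : Type*} [Fintype V] (G : SimpleGraph V) (t : ℕ)
    (δ : Config V C) (s : C × ℕ) (x : V) :
    total (place G t δ s x) s.1 ≤ total δ s.1 + s.2 := by
  have h1 : total (place G t δ s x) s.1 ≤ ∑ z, ((if z = x then s.2 + neighborSum G δ s.1 x else 0)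
      + (if G.Adj x z then 0 else colorHeight (δ z) s.1)) := by
    unfold total
    apply Finset.sum_le_sum
    intro z _
    unfold place
    by_cases hz : z = x
    · subst hz
      simp only [if_true]
      split_ifs <;> simp [colorHeight]
    · simp only [hz, if_false, zero_add]
      by_cases ha : G.Adj x z
      · simp only [ha, true_and, if_true]
        split_ifs with h
        · simp [colorHeight]
        · rcases hd : δ z with _ | ⟨c', h'⟩
          · simp [colorHeight]
          · have : c' ≠ s.1 := by
              rintro rfl
              exact h ⟨h', hd⟩
            simp [colorHeight, this]
      · simp [ha]
  refine h1.trans (le_of_eq ?_)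
  rw [Finset.sum_add_distrib, Finset.sum_ite_eq' Finset.univ x]
  simp only [Finset.mem_univ, if_true, neighborSum, total, Finset.sum_filter]
  have : ∑ z, colorHeight (δ z) s.1 = (∑ z, if G.Adj x z then colorHeight (δ z) s.1 else 0)
      + ∑ z, if G.Adj x z then 0 else colorHeight (δ z) s.1 := by
    rw [← Finset.sum_add_distrib]
    apply Finset.sum_congr rfl
    intro z _
    split_ifs <;> simp
  omega

lemma main_aux {V C : Type*} [Fintype V] [Fintype C] (G : SimpleGraph V)
    (t : ℕ) (ht : 1 ≤ t) (v : V) (hdeg : Fintype.card C * t ≤ (G.neighborSet v).ncard)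
    (S : List (C × ℕ)) : ∀ (δ : Config V C), (∀ s ∈ S, 1 ≤ s.2) →
    (∀ z, δ z ≠ none → G.Adj v z) → (∀ z c h, δ z = some (c, h) → 1 ≤ h) →
    (∀ c, total δ c < t) → ∃ p, Legal G t δ S p := by
  induction S with
  | nil => exact fun δ _ _ _ _ => ⟨[], Legal.nil δ⟩
  | cons s S ih =>
    intro δ hS hN hh hT
    have hs : 1 ≤ s.2 := hS s (by simp)
    have hS' : ∀ s ∈ S, 1 ≤ s.2 := fun a ha => hS a (by simp [ha])
    have hpos' : ∀ x z c h, place G t δ s x z = some (c, h) → 1 ≤ h := by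
      intro x z c h hp
      unfold place at hp
      split_ifs at hp
      · simp only [Option.some.injEq, Prod.ext_iff] at hp
        have := hp.2
        omega
      · exact hh _ _ _ hp
    have hv : δ v = none := by
      by_contra hc
      exact (hN v hc).ne rfl
    by_cases hbig : t ≤ s.2 + total δ s.1
    · have hns : neighborSum G δ s.1 v = total δ s.1 := by
        unfold neighborSum total
        rw [Finset.sum_filter]
        apply Finset.sum_congr rfl
        intro z _
        split_ifs with ha
        · rfl
        · have : δ z = none := by
            by_contra hc
            exact ha (hN z hc)
          simp [this, colorHeight]
      have hle : ∀ z, place G t δ s v z ≠ none → place G t δ s v z = δ z := by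
        intro z hz
        unfold place at hz ⊢
        simp only [hns, hbig, if_true] at hz ⊢
        split_ifs at hz ⊢ <;> simp_all
      obtain ⟨p, hp⟩ := ih (place G t δ s v) hS'
        (fun z hz => hN z (by rw [← hle z hz]; exact hz)) (hpos' v) (by
          intro c
          by_cases hc : s.1 = c
          · have : total (place G t δ s v) c = 0 := by
              unfold total
              apply Finset.sum_eq_zero
              intro z _
              rcases hz : place G t δ s v z with _ | ⟨c', h'⟩
              · rfl
              · by_cases hcc : c' = c
                · exfalso
                  have h2 := hle z (by simp [hz])
                  rw [hz] at h2
                  have ha := hN z (by simp [← h2])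
                  unfold place at hz
                  rw [if_neg ha.ne', if_pos ⟨ha, h', by rw [← h2, hcc, hc]⟩] at hz
                  cases hz
                · simp [colorHeight, hcc]
            omega
          · exact (total_place_ne G t δ s v c hc).trans_lt (hT c))
      exact ⟨v :: p, Legal.cons s S v p hv hp⟩
    · obtain ⟨y, hy, hyn⟩ : ∃ y, G.Adj v y ∧ δ y = none := by
        by_contra hcon
        push Not at hcon
        have e1 : (G.neighborSet v).ncard = (Finset.univ.filter (fun y => G.Adj v y)).card := by
          rw [← Set.ncard_coe_finset]
          congr 1
          ext y
          simp
        have e2 : (Finset.univ.filter (fun y => G.Adj v y)).card ≤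
            ∑ z : V, ∑ c : C, colorHeight (δ z) c := by
          rw [Finset.card_eq_sum_ones, Finset.sum_filter]
          apply Finset.sum_le_sum
          intro z _
          split_ifs with ha
          · rcases hd : δ z with _ | ⟨c', h'⟩
            · exact absurd hd (hcon z ha)
            · have := hh _ _ _ hd
              simpa [colorHeight] using this
          · simp
        rw [Finset.sum_comm] at e2
        have e3 : ∑ c : C, ∑ z : V, colorHeight (δ z) c < ∑ c : C, t :=
          Finset.sum_lt_sum_of_nonempty ⟨s.1, Finset.mem_univ _⟩ (fun c _ => hT c)
        simp at e3
        omega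
      obtain ⟨p, hp⟩ := ih (place G t δ s y) hS' (by
          intro z hz
          by_cases hzy : z = y
          · rw [hzy]; exact hy
          · apply hN
            unfold place at hz
            rw [if_neg hzy] at hz
            split_ifs at hz
            · exact absurd rfl hz
            · exact hz) (hpos' y) (by
          intro c
          by_cases hc : s.1 = c
          · subst hc
            have := total_place_eq G t δ s y
            omega
          · exact (total_place_ne G t δ s y c hc).trans_lt (hT c))
      exact ⟨y :: p, Legal.cons s S y p hyn hp⟩

/-- if `G` contains a vertex of degree at least `|C| · t`,
then `S` is fittable. -/
theorem statement_11 {V C : Type*} [Fintype V] [Fintype C] (G : SimpleGraph V)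
    (t : ℕ) (ht : 1 ≤ t) (S : List (C × ℕ)) (hpos : ∀ s ∈ S, 1 ≤ s.2)
    (v : V) (hdeg : Fintype.card C * t ≤ (G.neighborSet v).ncard) :
    Fittable G t S := by
  apply main_aux G t ht v hdeg S _ hpos
  · intro z hz
    exact absurd rfl hz
  · intro z c h hz
    cases hz
  · intro c
    simp only [total, emptyConfig, colorHeight, Finset.sum_const_zero]
    omega

end Hexasort
end

section
/- In any configuration reachable from the everywhere-empty configuration by a sequence of legal stack placements, no two adjacent vertices of G simultaneously hold stacks of the same color. -/
open scoped Classical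

namespace Hexasort

/-- No two adjacent vertices hold stacks of the same color. -/
def Proper {V C : Type*} (G : SimpleGraph V) (δ : Config V C) : Prop :=
  ∀ u v, G.Adj u v → ∀ (c : C) (h h' : ℕ), δ u = some (c, h) → δ v = some (c, h') → False

lemma proper_place {V C : Type*} [Fintype V] (G : SimpleGraph V) (t : ℕ)
    (δ : Config V C) (s : C × ℕ) (x : V) (hp : Proper G δ) : Proper G (place G t δ s x) := by
  intro u v huv c h h' hu hv
  have hne := huv.ne
  have hvu := huv.symm
  have hp' := hp u v huv c h h'
  unfold place at hu hv
  split_ifs at hu hv <;> simp_all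

lemma proper_play {V C : Type*} [Fintype V] (G : SimpleGraph V) (t : ℕ)
    (S : List (C × ℕ)) : ∀ (δ : Config V C) (p : List V), Proper G δ →
      Proper G (play G t δ S p) := by
  induction S with
  | nil => intro δ p h; simpa [play] using h
  | cons s S ih =>
    intro δ p h
    cases p with
    | nil => simpa [play] using h
    | cons x p => exact ih _ _ (proper_place G t δ s x h)

/-- in any configuration reachable from the everywhere-empty
configuration by legal placements, no two adjacent vertices hold stacks of the
same color. -/
theorem statement_14 {V C : Type*} [Fintype V] (G : SimpleGraph V) (t : ℕ)
    (δ : Config V C) (S : List (C × ℕ)) (p : List V)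
    (hleg : Legal G t (emptyConfig V C) S p)
    (hδ : δ = play G t (emptyConfig V C) S p)
    (u v : V) (huv : G.Adj u v) (c : C) (h h' : ℕ) :
    ¬ (δ u = some (c, h) ∧ δ v = some (c, h')) := by
  rintro ⟨hu, hv⟩
  subst hδ
  refine proper_play G t S (emptyConfig V C) p ?_ u v huv c h h' hu hv
  intro a b _ c h h' ha
  simp [emptyConfig] at ha

end Hexasort
end

section
/- Let (G, S, t) be a Hexasort instance and let S' be obtained from S by replacing every stack (c,h) with (c, min(h,t)). Then S is emptyable on (G, t) if and only if S' is emptyable on (G, t), and S is fittable on (G, t) if and only if S' is fittable on (G, t). -/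
open scoped Classical

namespace Hexasort

theorem place_cap {V C : Type*} [Fintype V] (G : SimpleGraph V) (t : ℕ)
    (δ : Config V C) (s : C × ℕ) (x : V) :
    place G t δ (s.1, min s.2 t) x = place G t δ s x := by
  rcases le_total s.2 t with h | h
  · rw [min_eq_left h]
  · have h1 : t ≤ t + neighborSum G δ s.1 x := Nat.le_add_right _ _
    have h2 : t ≤ s.2 + neighborSum G δ s.1 x := le_trans h (Nat.le_add_right _ _)
    funext v
    simp only [place, min_eq_right h, if_pos h1, if_pos h2]

theorem play_cap {V C : Type*} [Fintype V] (G : SimpleGraph V) (t : ℕ)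
    (S : List (C × ℕ)) : ∀ (δ : Config V C) (p : List V),
    play G t δ (S.map (fun s => (s.1, min s.2 t))) p = play G t δ S p := by
  induction S with
  | nil => intro δ p; rfl
  | cons s S ih =>
    intro δ p
    cases p with
    | nil => rfl
    | cons x p =>
      simp only [List.map_cons, play]
      rw [place_cap, ih]

theorem legal_cap {V C : Type*} [Fintype V] (G : SimpleGraph V) (t : ℕ)
    (S : List (C × ℕ)) : ∀ (δ : Config V C) (p : List V),
    Legal G t δ (S.map (fun s => (s.1, min s.2 t))) p ↔ Legal G t δ S p := by
  induction S with
  | nil => intro δ p; rfl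
  | cons s S ih =>
    intro δ p
    rw [List.map_cons]
    constructor
    · intro h
      cases h with
      | cons _ _ x p h1 h2 =>
        rw [place_cap, ih] at h2
        exact Legal.cons s S x p h1 h2
    · intro h
      cases h with
      | cons _ _ x p h1 h2 =>
        refine Legal.cons _ _ x p h1 ?_
        rw [place_cap, ih]
        exact h2

/-- Height normalization: capping every stack height at `t` preserves
both emptyability and fittability. -/
theorem statement_15 {V C : Type*} [Fintype V] (G : SimpleGraph V) (t : ℕ)
    (ht : 1 ≤ t) (S : List (C × ℕ)) (hpos : ∀ s ∈ S, 1 ≤ s.2) :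
    (Emptyable G t S ↔ Emptyable G t (S.map (fun s => (s.1, min s.2 t)))) ∧
    (Fittable G t S ↔ Fittable G t (S.map (fun s => (s.1, min s.2 t)))) := by
  simp only [Emptyable, Fittable, legal_cap, play_cap, and_self]

end Hexasort
end

section
/- Let (G, S, t) be a Hexasort instance with t ≥ 2, let n = |V(G)| ≥ 1, let C be the set of colors appearing in S, and let S⁺ = S + ⟨(d_1, 1), …, (d_n, 1)⟩, where d_1, …, d_n are pairwise distinct colors none of which belongs to C. Then S is emptyable on (G, t) if and only if S⁺ is fittable on (G, t). -/
open scoped Classical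

namespace Hexasort

theorem aux_append {V C : Type*} [Fintype V] (G : SimpleGraph V) (t : ℕ)
    (A B : List (C × ℕ)) (δ : Config V C) :
    (∃ p, Legal G t δ (A ++ B) p) ↔
      ∃ p, Legal G t δ A p ∧ ∃ q, Legal G t (play G t δ A p) B q := by
  induction A generalizing δ with
  | nil =>
    constructor
    · rintro ⟨p, hp⟩
      exact ⟨[], Legal.nil _, p, hp⟩
    · rintro ⟨p, hp, q, hq⟩
      exact ⟨q, by simpa [play] using hq⟩
  | cons s A ih =>
    constructor
    · rintro ⟨p, hp⟩
      cases hp with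
      | cons _ _ x p hx hp =>
        obtain ⟨p1, h1, q, hq⟩ := (ih _).1 ⟨p, hp⟩
        exact ⟨x :: p1, Legal.cons _ _ _ _ hx h1, q, hq⟩
    · rintro ⟨p, hp, q, hq⟩
      cases hp with
      | cons _ _ x p hx hp =>
        obtain ⟨r, hr⟩ := (ih _).2 ⟨p, hp, q, hq⟩
        exact ⟨x :: r, Legal.cons _ _ _ _ hx hr⟩

theorem aux_colors {V C : Type*} [Fintype V] (G : SimpleGraph V) (t : ℕ) (c : C)
    (A : List (C × ℕ)) (δ : Config V C) (p : List V)
    (hA : ∀ s ∈ A, s.1 ≠ c) (hδ : ∀ v h, δ v ≠ some (c, h)) :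
    ∀ v h, play G t δ A p v ≠ some (c, h) := by
  induction A generalizing δ p with
  | nil => simpa [play] using hδ
  | cons s A ih =>
    cases p with
    | nil => simpa [play] using hδ
    | cons x p =>
      simp only [play]
      apply ih
      · intro s' hs'
        exact hA s' (List.mem_cons_of_mem _ hs')
      · intro v h
        have h1 := hA s List.mem_cons_self
        have h2 := hδ v h
        unfold place
        split_ifs
        · simp
        · simp [h1]
        · simp
        · exact h2

theorem aux_place {V C : Type*} [Fintype V] (G : SimpleGraph V) (t : ℕ) (ht : 2 ≤ t) (c : C)
    (δ : Config V C) (x : V) (hδ : ∀ v h, δ v ≠ some (c, h)) :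
    place G t δ (c, 1) x = Function.update δ x (some (c, 1)) := by
  have h0 : neighborSum G δ c x = 0 := by
    unfold neighborSum
    apply Finset.sum_eq_zero
    intro y _
    have := hδ y
    rcases hy : δ y with _ | ⟨c', h'⟩
    · rfl
    · have : c' ≠ c := by
        rintro rfl
        exact this _ hy
      simp [colorHeight, this]
  funext v
  by_cases hv : v = x
  · subst hv
    have : ¬ t ≤ 1 := by omega
    simp [place, h0, this]
  · simp [place, hv, hδ]

theorem aux_fresh {V C : Type*} [Fintype V] (G : SimpleGraph V) (t : ℕ) (ht : 2 ≤ t)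
    (L : List C) (hL : L.Nodup) (δ : Config V C) (hδ : ∀ c ∈ L, ∀ v h, δ v ≠ some (c, h)) :
    (∃ p, Legal G t δ (L.map (fun c => (c, 1))) p) ↔
      L.length ≤ (Finset.univ.filter (fun v => δ v = none)).card := by
  induction L generalizing δ with
  | nil => simpa using ⟨[], Legal.nil _⟩
  | cons c L ih =>
    have hc := hδ c List.mem_cons_self
    rw [List.nodup_cons] at hL
    have key : ∀ x, δ x = none →
        ((∃ p, Legal G t (place G t δ (c, 1) x) (L.map (fun c => (c, 1))) p) ↔
          L.length + 1 ≤ (Finset.univ.filter (fun v => δ v = none)).card) := by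
      intro x hx
      rw [aux_place G t ht c δ x hc, ih hL.2]
      · have : (Finset.univ.filter (fun v => Function.update δ x (some (c, 1)) v = none))
            = (Finset.univ.filter (fun v => δ v = none)).erase x := by
          ext v
          by_cases hv : v = x
          · subst hv; simp
          · simp [hv]
        rw [this, Finset.card_erase_of_mem (by simp [hx])]
        have : 0 < (Finset.univ.filter (fun v => δ v = none)).card :=
          Finset.card_pos.2 ⟨x, by simp [hx]⟩
        omega
      · intro c' hc' v h
        by_cases hv : v = x
        · subst hv
          have : c ≠ c' := by
            rintro rfl
            exact hL.1 hc'
          simp [this]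
        · simpa [hv] using hδ c' (List.mem_cons_of_mem _ hc') v h
    rw [List.length_cons]
    constructor
    · rintro ⟨p, hp⟩
      cases hp with
      | cons _ _ x p hx hp => exact (key x hx).1 ⟨p, hp⟩
    · intro hcard
      obtain ⟨x, hx⟩ := Finset.card_pos.1 (lt_of_lt_of_le (Nat.succ_pos _) hcard)
      have hx : δ x = none := by simpa using hx
      obtain ⟨p, hp⟩ := (key x hx).2 hcard
      exact ⟨x :: p, Legal.cons _ _ _ _ hx hp⟩

/-- with `t ≥ 2` and `n = |V| ≥ 1`, `S` is emptyable iff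
`S⁺ = S + ⟨(d₁,1),…,(d_n,1)⟩` is fittable, where the `d_i` are pairwise distinct fresh
colors not appearing in `S`. -/
theorem statement_17 {V C : Type*} [Fintype V] (G : SimpleGraph V) (t : ℕ)
    (ht : 2 ≤ t) (hV : 1 ≤ Fintype.card V)
    (S : List (C × ℕ)) (hpos : ∀ s ∈ S, 1 ≤ s.2)
    (d : Fin (Fintype.card V) → C) (hd : Function.Injective d)
    (hnew : ∀ i, ∀ s ∈ S, s.1 ≠ d i) :
    Emptyable G t S ↔
      Fittable G t (S ++ (List.finRange (Fintype.card V)).map (fun i => (d i, 1))) := by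
  have hmap : (List.finRange (Fintype.card V)).map (fun i => (d i, 1))
      = ((List.finRange (Fintype.card V)).map d).map (fun c => (c, 1)) := by simp
  unfold Fittable Emptyable
  rw [aux_append]
  apply exists_congr
  intro p
  apply and_congr_right
  intro _
  rw [hmap, aux_fresh G t ht _ ((List.nodup_finRange _).map hd)]
  · rw [List.length_map, List.length_finRange]
    constructor
    · intro h
      rw [h]
      simp [emptyConfig]
    · intro h
      have h2 := Finset.eq_univ_of_card _ (le_antisymm (Finset.card_le_univ _) h)
      funext v
      have h3 := Finset.mem_univ v
      rw [← h2] at h3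
      simpa [emptyConfig] using h3
  · intro c hc
    obtain ⟨i, -, rfl⟩ := List.mem_map.1 hc
    apply aux_colors
    · exact hnew i
    · simp [emptyConfig]

end Hexasort
end
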